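/- Assume X has a minimal subspace segmentation {X_1, …, X_K} with no pure segment such that no sample lies in S_k ∩ S_ℓ for k ≠ ℓ and {X_1, …, X_K} is intersected nondegenerately, and let J = {J_1, …, J_K} ∈ J(K, d, d_min). If a piece J_i satisfies r(X_{J_i}) = d_min and |J_i| > d_min, then J_i ⊆ J_k* for some k with d_k = d_min. -/

import Mathlib

open Submodule Module Finset

noncomputable section

variable {m : ℕ} {ι : Type*}

/-- The subspace spanned by the subfamily of `x` indexed by `S`. -/
def spanOf (x : ι → EuclideanSpace ℝ (Fin m)) (S : Finset ι) :
    Submodule ℝ (EuclideanSpace ℝ (Fin m)) :=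
  Submodule.span ℝ (x '' (S : Set ι))

/-- The rank `r(X_S)` of the subfamily of `x` indexed by `S`. -/
def rOf (x : ι → EuclideanSpace ℝ (Fin m)) (S : Finset ι) : ℕ :=
  Module.finrank ℝ (spanOf x S)

/-- `X_S` is nondegenerate: every subfamily `X_T`, `T ⊆ S`, has rank `min |T| r(X_S)`. -/
def Nondeg (x : ι → EuclideanSpace ℝ (Fin m)) (S : Finset ι) : Prop :=
  ∀ T ⊆ S, rOf x T = min T.card (rOf x S)

/-- `span(X_S)` is a minimal sample subspace: `n(X_S) > r(X_S)` and `X_S` is nondegenerate. -/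
def IsMinimalSeg (x : ι → EuclideanSpace ℝ (Fin m)) (S : Finset ι) : Prop :=
  rOf x S < S.card ∧ Nondeg x S

/-- The component of `x i` in the orthogonal complement of `W ⊓ S'` within `W`. -/
def zComp (x : ι → EuclideanSpace ℝ (Fin m))
    (W S' : Submodule ℝ (EuclideanSpace ℝ (Fin m))) (i : ι) :
    EuclideanSpace ℝ (Fin m) :=
  (orthogonalProjection (W ⊓ (W ⊓ S')ᗮ) (x i) : EuclideanSpace ℝ (Fin m))

/-- The segmentation `{X_1, …, X_K}` is intersected nondegenerately: for every `k` and every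
subfamily indexed by `S` disjoint from `P k`, the family of components of the vectors of `X_k`
in the orthogonal complement (within `span(X_k)`) of `span(X_k) ⊓ span(X_S)` is zero or
nondegenerate. -/
def IntNondeg (x : ι → EuclideanSpace ℝ (Fin m)) {K : ℕ}
    (P : Fin K → Finset ι) : Prop :=
  ∀ (k : Fin K) (S : Finset ι), Disjoint S (P k) →
    (∀ i ∈ P k, zComp x (spanOf x (P k)) (spanOf x S) i = 0) ∨
      Nondeg (zComp x (spanOf x (P k)) (spanOf x S)) (P k)

/-- A minimal subspace segmentation of `X` with no pure segment, with index pieces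
`P 1, …, P K`. -/
structure IsMSSnp (x : ι → EuclideanSpace ℝ (Fin m)) {K : ℕ}
    (P : Fin K → Finset ι) : Prop where
  cover : ∀ i : ι, ∃ k, i ∈ P k
  disj : ∀ k ℓ, k ≠ ℓ → Disjoint (P k) (P ℓ)
  minimal : ∀ k, IsMinimalSeg x (P k)
  distinct : ∀ k ℓ, k ≠ ℓ → spanOf x (P k) ≠ spanOf x (P ℓ)

/-- The non-intersection condition for the minimal segments. -/
def NonIntersect (x : ι → EuclideanSpace ℝ (Fin m)) {K : ℕ}
    (P : Fin K → Finset ι) : Prop :=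
  ∀ (j : ι) (k ℓ : Fin K), k ≠ ℓ → x j ∉ spanOf x (P k) ⊓ spanOf x (P ℓ)

/-- The set `𝒥(K, d, dmin)`: partitions of the index set into `K` pieces, each of size
greater than `dmin`, whose segment ranks sum to at most `d`. -/
def InJSet (x : ι → EuclideanSpace ℝ (Fin m)) (K d dmin : ℕ)
    (Q : Fin K → Finset ι) : Prop :=
  (∀ i : ι, ∃ k, i ∈ Q k) ∧ (∀ k ℓ, k ≠ ℓ → Disjoint (Q k) (Q ℓ)) ∧
    (∀ k, dmin < (Q k).card) ∧ (∑ k, rOf x (Q k)) ≤ d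

lemma zComp_eq_starProjection (x : ι → EuclideanSpace ℝ (Fin m))
    (W S' : Submodule ℝ (EuclideanSpace ℝ (Fin m))) :
    zComp x W S' = (W ⊓ (W ⊓ S')ᗮ).starProjection ∘ x := rfl

lemma spanOf_comp (x : ι → EuclideanSpace ℝ (Fin m))
    (f : EuclideanSpace ℝ (Fin m) →ₗ[ℝ] EuclideanSpace ℝ (Fin m)) (S : Finset ι) :
    spanOf (f ∘ x) S = (spanOf x S).map f := by
  rw [spanOf, spanOf, Submodule.map_span, Set.image_comp]

lemma spanOf_mono (x : ι → EuclideanSpace ℝ (Fin m)) {S T : Finset ι} (h : S ⊆ T) :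
    spanOf x S ≤ spanOf x T :=
  Submodule.span_mono (Set.image_mono (Finset.coe_subset.mpr h))

lemma spanOf_union [DecidableEq ι] (x : ι → EuclideanSpace ℝ (Fin m)) (S T : Finset ι) :
    spanOf x (S ∪ T) = spanOf x S ⊔ spanOf x T := by
  rw [spanOf, Finset.coe_union, Set.image_union, Submodule.span_union, spanOf, spanOf]

lemma mem_spanOf (x : ι → EuclideanSpace ℝ (Fin m)) {S : Finset ι} {j : ι} (hj : j ∈ S) :
    x j ∈ spanOf x S :=
  Submodule.subset_span (Set.mem_image_of_mem x hj)

lemma rOf_le_card (x : ι → EuclideanSpace ℝ (Fin m)) (S : Finset ι) : rOf x S ≤ S.card := by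
  classical
  have h := finrank_span_finset_le_card (R := ℝ) (S.image x)
  rw [Finset.coe_image] at h
  exact h.trans Finset.card_image_le

lemma rOf_union_le [DecidableEq ι] (x : ι → EuclideanSpace ℝ (Fin m)) (S T : Finset ι) :
    rOf x (S ∪ T) ≤ rOf x S + rOf x T := by
  rw [rOf, spanOf_union]
  exact Submodule.finrank_add_le_finrank_add_finrank _ _

/-- A subfamily whose rank is less than its size has a redundant vector. -/
lemma exists_rOf_erase_eq [DecidableEq ι] (x : ι → EuclideanSpace ℝ (Fin m)) {S : Finset ι}
    (h : rOf x S < S.card) : ∃ j ∈ S, rOf x (S.erase j) = rOf x S := by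
  have hdep : ¬ LinearIndepOn ℝ x (S : Set ι) := by
    intro hli
    have hfr := finrank_span_eq_card hli
    rw [← Set.image_eq_range] at hfr
    simp only [SetLike.coe_sort_coe, Fintype.card_coe] at hfr
    exact h.ne hfr
  rw [linearIndepOn_iff_notMem_span] at hdep
  push Not at hdep
  obtain ⟨j, hj, hmem⟩ := hdep
  refine ⟨j, hj, ?_⟩
  rw [← Finset.coe_erase] at hmem
  have heq : spanOf x S = spanOf x (S.erase j) := by
    refine le_antisymm (Submodule.span_le.mpr ?_) (spanOf_mono x (Finset.erase_subset _ _))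
    rintro _ ⟨i, hi, rfl⟩
    by_cases hij : i = j
    · subst hij
      exact hmem
    · exact mem_spanOf x (Finset.mem_erase.mpr ⟨hij, hi⟩)
  rw [rOf, rOf, heq]

/-- Projecting a subspace `A` of `W` onto the orthogonal complement of `W ⊓ S'` within `W`
leaves the rank that `A` adds to `S'`. -/
lemma finrank_map_starProjection_add
    {A W : Submodule ℝ (EuclideanSpace ℝ (Fin m))} (hA : A ≤ W)
    (S' : Submodule ℝ (EuclideanSpace ℝ (Fin m))) :
    finrank ℝ (A.map (W ⊓ (W ⊓ S')ᗮ).starProjection.toLinearMap) + finrank ℝ S' =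
      finrank ℝ (A ⊔ S' : Submodule ℝ (EuclideanSpace ℝ (Fin m))) := by
  set p := (W ⊓ (W ⊓ S')ᗮ).starProjection.toLinearMap with hp
  have hker : A ⊓ LinearMap.ker p = A ⊓ S' := by
    ext w
    simp only [Submodule.mem_inf, and_congr_right_iff]
    intro hw
    have hk : w ∈ LinearMap.ker p ↔ w ∈ (W ⊓ (W ⊓ S')ᗮ)ᗮ := by
      rw [hp, Submodule.ker_starProjection]
    rw [hk]
    constructor
    · intro h
      have hmem := (W ⊓ S').starProjection_apply_mem w
      have hb : w - (W ⊓ S').starProjection w ∈ W ⊓ (W ⊓ S')ᗮ :=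
        ⟨W.sub_mem (hA hw) hmem.1, Submodule.sub_starProjection_mem_orthogonal w⟩
      have hb' : w - (W ⊓ S').starProjection w ∈ (W ⊓ (W ⊓ S')ᗮ)ᗮ :=
        Submodule.sub_mem _ h
          (Submodule.orthogonal_le inf_le_right (Submodule.le_orthogonal_orthogonal _ hmem))
      have h0 : w - (W ⊓ S').starProjection w = 0 := by
        rw [← Submodule.mem_bot ℝ, ← Submodule.inf_orthogonal_eq_bot (W ⊓ (W ⊓ S')ᗮ)]
        exact ⟨hb, hb'⟩
      rw [sub_eq_zero.mp h0]
      exact hmem.2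
    · intro h
      exact Submodule.orthogonal_le inf_le_right
        (Submodule.le_orthogonal_orthogonal _ ⟨hA hw, h⟩)
  have hrn := LinearMap.finrank_range_add_finrank_ker (p.domRestrict A)
  rw [LinearMap.range_domRestrict, LinearMap.ker_domRestrict,
    ← Submodule.finrank_map_subtype_eq, Submodule.map_comap_subtype, hker] at hrn
  have hsup := Submodule.finrank_sup_add_finrank_inf_eq A S'
  omega

lemma rOf_zComp_add [DecidableEq ι] (x : ι → EuclideanSpace ℝ (Fin m)) {T P : Finset ι}
    (hT : T ⊆ P) (S : Finset ι) :
    rOf (zComp x (spanOf x P) (spanOf x S)) T + rOf x S = rOf x (T ∪ S) := by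
  rw [rOf, rOf, rOf, spanOf_union, zComp_eq_starProjection,
    ← finrank_map_starProjection_add (spanOf_mono x hT) (spanOf x S)]
  congr 1
  exact congrArg (fun V : Submodule ℝ (EuclideanSpace ℝ (Fin m)) => finrank ℝ V)
    (spanOf_comp x (spanOf x P ⊓ (spanOf x P ⊓ spanOf x S)ᗮ).starProjection.toLinearMap T)

/-- If adding `X_T`, `T ⊆ P k`, to an outside subfamily `X_S` raises the rank by less than
`|T|`, then it already raises it as much as adding all of `X_k`. -/
lemma IntNondeg.rOf_union_eq [DecidableEq ι] {x : ι → EuclideanSpace ℝ (Fin m)} {K : ℕ}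
    {P : Fin K → Finset ι} (hnd : IntNondeg x P) {k : Fin K} {S T : Finset ι}
    (hS : Disjoint S (P k)) (hT : T ⊆ P k) (hlt : rOf x (T ∪ S) < T.card + rOf x S) :
    rOf x (T ∪ S) = rOf x (P k ∪ S) := by
  rw [← rOf_zComp_add x hT] at hlt ⊢
  rw [← rOf_zComp_add x (Finset.Subset.refl (P k))]
  rcases hnd k S hS with h0 | hz
  · have hbot : ∀ U ⊆ P k, rOf (zComp x (spanOf x (P k)) (spanOf x S)) U = 0 := by
      intro U hU
      rw [rOf, Submodule.finrank_eq_zero, spanOf, Submodule.span_eq_bot]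
      rintro _ ⟨i, hi, rfl⟩
      exact h0 i (hU hi)
    rw [hbot T hT, hbot _ (Finset.Subset.refl _)]
  · have := hz T hT
    lia

/-- If a piece `J_i` of a partition in `𝒥(K, d, dmin)` satisfies
`r(X_{J_i}) = d_min` and `|J_i| > d_min`, then `J_i ⊆ J_k*` for some `k` with `d_k = d_min`. -/
theorem piece_subset_of_rank_eq_dmin [Fintype ι] [DecidableEq ι]
    (x : ι → EuclideanSpace ℝ (Fin m)) {K : ℕ} (P : Fin K → Finset ι)
    (hmss : IsMSSnp x P) (hni : NonIntersect x P) (hnd : IntNondeg x P)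
    (d dmin : ℕ)
    (hd : d = ∑ k, rOf x (P k))
    (hdmin : IsLeast (Set.range fun k => rOf x (P k)) dmin)
    (Q : Fin K → Finset ι) (hQ : InJSet x K d dmin Q)
    (i : Fin K) (hri : rOf x (Q i) = dmin) (hcard : dmin < (Q i).card) :
    ∃ k : Fin K, Q i ⊆ P k ∧ rOf x (P k) = dmin := by
  obtain ⟨j, hj, hjr⟩ := exists_rOf_erase_eq x (hri.trans_lt hcard)
  obtain ⟨k, hjk⟩ := hmss.cover j
  have hsub : Q i ⊆ P k := by
    set T := Q i ∩ P k with hT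
    set S := Q i \ P k with hS
    have hTS : T ∪ S = Q i := by
      rw [hT, hS, Finset.union_comm, Finset.sdiff_union_inter]
    have hjT : j ∈ T := Finset.mem_inter.mpr ⟨hj, hjk⟩
    have herase : (Q i).erase j ⊆ T.erase j ∪ S := by
      intro a ha
      by_cases hak : a ∈ P k <;> simp_all
    have hle : rOf x ((Q i).erase j) ≤ rOf x (T.erase j) + rOf x S :=
      (Submodule.finrank_mono (spanOf_mono x herase)).trans (rOf_union_le x _ _)
    have hTcard := rOf_le_card x (T.erase j)
    have hpos := Finset.card_erase_add_one hjT
    have hrank : rOf x (T ∪ S) = rOf x (P k ∪ S) :=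
      hnd.rOf_union_eq Finset.sdiff_disjoint Finset.inter_subset_right (by rw [hTS]; lia)
    have hspan : spanOf x (P k) = spanOf x (P k ∪ S) := by
      refine Submodule.eq_of_le_of_finrank_le (spanOf_mono x Finset.subset_union_left) ?_
      change rOf x (P k ∪ S) ≤ rOf x (P k)
      rw [← hrank, hTS, hri]
      exact hdmin.2 ⟨k, rfl⟩
    intro a ha
    by_contra hak
    obtain ⟨l, hal⟩ := hmss.cover a
    refine hni a k l (fun h => hak (h ▸ hal)) ⟨?_, mem_spanOf x hal⟩
    rw [hspan]
    exact mem_spanOf x (Finset.mem_union_right _ (Finset.mem_sdiff.mpr ⟨ha, hak⟩))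
  refine ⟨k, hsub, ?_⟩
  have := (hmss.minimal k).2 (Q i) hsub
  lia
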